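/- arXiv:math/0512134 — 3 statements merged into one kernel-verified Lean document; each statement's English description precedes it below -/
import Mathlib

section
/- Let N ≥ 3, let a_1,...,a_N be positive integers, and let t > 0. The inradius r(t) of the simplex S(t) = {x ∈ ℝ^N_{≥0} : Σ_{i=1}^N a_i x_i = t} (the radius of the largest (N−1)-dimensional ball contained in S(t)) satisfies r(t) ≥ t·‖a‖ / ((N−1)·Σ_{i=1}^N √(‖a‖² − a_i²)·a_i). -/
open scoped BigOperators

/-- A vector orthogonal to `a` has a small `i`-th coordinate compared to its length. -/
theorem sum_sq_mul_sq_le_of_sum_mul_eq_zero {ι : Type*} [Fintype ι] (a d : ι → ℝ)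
    (h : ∑ j, a j * d j = 0) (i : ι) :
    (∑ j, a j ^ 2) * d i ^ 2 ≤ ((∑ j, a j ^ 2) - a i ^ 2) * ∑ j, d j ^ 2 := by
  classical
  have hcs := Finset.sum_mul_sq_le_sq_mul_sq (Finset.univ.erase i) a d
  have h₁ := Finset.add_sum_erase Finset.univ (fun j => a j * d j) (Finset.mem_univ i)
  have h₂ := Finset.add_sum_erase Finset.univ (fun j => a j ^ 2) (Finset.mem_univ i)
  have h₃ := Finset.add_sum_erase Finset.univ (fun j => d j ^ 2) (Finset.mem_univ i)
  rw [h] at h₁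
  rw [← h₂, ← h₃]
  have h₄ : ∑ j ∈ Finset.univ.erase i, a j * d j = -(a i * d i) := by linarith
  rw [h₄] at hcs
  nlinarith

/-- The radii of the balls contained in a simplex `∑ i, a i * x i = t`, `0 ≤ x`, are bounded. -/
theorem bddAbove_simplex_ball_radii {ι : Type*} [Fintype ι] [Nontrivial ι] (a : ι → ℝ)
    (ha : ∀ i, 0 < a i) (t : ℝ) (ht : 0 ≤ t) :
    BddAbove {ρ : ℝ | ∃ c : EuclideanSpace ℝ ι,
        (∑ i, a i * c i = t) ∧
        ∀ y : EuclideanSpace ℝ ι,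
          dist y c ≤ ρ → (∑ i, a i * y i = t) → ∀ i, 0 ≤ y i} := by
  classical
  obtain ⟨p, q, hpq⟩ := exists_pair_ne ι
  set v : EuclideanSpace ℝ ι :=
    EuclideanSpace.single p (a q) - EuclideanSpace.single q (a p) with hv
  have hvp : v p = a q := by simp [hv, hpq]
  have hav : ∑ i, a i * v i = 0 := by
    simp [hv, mul_sub, Finset.sum_sub_distrib, mul_comm]
  have hv0 : 0 < ‖v‖ := by
    rw [norm_pos_iff]
    intro h0
    rw [h0] at hvp
    exact (ha q).ne hvp
  refine ⟨t / a p * ‖v‖ / a q, ?_⟩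
  rintro ρ ⟨c, hc, hball⟩
  have hap := ha p
  have haq := ha q
  rcases lt_or_ge ρ 0 with hρ | hρ
  · exact hρ.le.trans (by positivity)
  have hc0 : ∀ i, 0 ≤ c i := hball c (by simpa using hρ) hc
  have hcp : c p ≤ t / a p := by
    rw [le_div_iff₀ hap, ← hc, mul_comm]
    exact Finset.single_le_sum (f := fun i => a i * c i)
      (fun i _ => mul_nonneg (ha i).le (hc0 i)) (Finset.mem_univ p)
  have hy : 0 ≤ (c - (ρ / ‖v‖) • v) p := by
    refine hball _ ?_ ?_ p
    · rw [dist_eq_norm, sub_sub_cancel_left, norm_neg, norm_smul, Real.norm_of_nonneg (by positivity),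
        div_mul_cancel₀ _ hv0.ne']
    · simp only [PiLp.sub_apply, PiLp.smul_apply, smul_eq_mul, mul_sub, Finset.sum_sub_distrib, hc,
        mul_left_comm _ (ρ / ‖v‖), ← Finset.mul_sum, hav, mul_zero, sub_zero]
  simp only [PiLp.sub_apply, PiLp.smul_apply, smul_eq_mul, hvp] at hy
  rw [le_div_iff₀ haq, ← div_le_iff₀ hv0, mul_div_right_comm]
  linarith

theorem inradius_frobenius_simplex_lower_bound
    (N : ℕ) (hN : 3 ≤ N) (a : Fin N → ℕ) (hpos : ∀ i, 0 < a i)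
    (t : ℝ) (ht : 0 < t) :
    t * Real.sqrt (∑ j, (a j : ℝ) ^ 2) /
        (((N : ℝ) - 1) *
          ∑ i, Real.sqrt ((∑ j, (a j : ℝ) ^ 2) - (a i : ℝ) ^ 2) * (a i : ℝ)) ≤
      sSup {ρ : ℝ | ∃ c : EuclideanSpace ℝ (Fin N),
        (∑ i, (a i : ℝ) * c i = t) ∧
        ∀ y : EuclideanSpace ℝ (Fin N),
          dist y c ≤ ρ → (∑ i, (a i : ℝ) * y i = t) → ∀ i, 0 ≤ y i} := by
  have ha : ∀ i, (0 : ℝ) < a i := fun i => by exact_mod_cast hpos i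
  have : Nontrivial (Fin N) := Fin.nontrivial_iff_two_le.mpr (by omega)
  set Q : ℝ := ∑ j, (a j : ℝ) ^ 2 with hQ
  have hlt : ∀ i, (a i : ℝ) ^ 2 < Q := fun i => by
    obtain ⟨j, hj⟩ := exists_ne i
    exact Finset.single_lt_sum (f := fun k => (a k : ℝ) ^ 2) hj (Finset.mem_univ i) (Finset.mem_univ j)
      (pow_pos (ha j) 2) (fun k _ _ => sq_nonneg _)
  have hs : ∀ i, 0 < √(Q - (a i : ℝ) ^ 2) := fun i => Real.sqrt_pos.mpr (sub_pos.mpr (hlt i))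
  have hQ0 : 0 < Q := (sq_nonneg _).trans_lt (hlt ⟨0, by omega⟩)
  set S : ℝ := ∑ i, √(Q - (a i : ℝ) ^ 2) * (a i : ℝ) with hS
  have hS0 : 0 < S := Finset.sum_pos (fun i _ => mul_pos (hs i) (ha i)) Finset.univ_nonempty
  have hN' : (3 : ℝ) ≤ N := by exact_mod_cast hN
  calc t * √Q / (((N : ℝ) - 1) * S) ≤ t * √Q / S := by
        gcongr
        nlinarith
    _ ≤ _ := by
        refine le_csSup (bddAbove_simplex_ball_radii (fun i => (a i : ℝ)) ha t ht.le) ?_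
        set c : EuclideanSpace ℝ (Fin N) :=
          WithLp.toLp 2 fun i => t / S * √(Q - (a i : ℝ) ^ 2) with hc
        have hct : ∑ i, (a i : ℝ) * c i = t := by
          have h : ∀ i, (a i : ℝ) * (t / S * √(Q - (a i : ℝ) ^ 2)) =
              t / S * (√(Q - (a i : ℝ) ^ 2) * a i) := fun i => by ring
          simp only [hc, h, ← Finset.mul_sum, ← hS]
          field_simp
        refine ⟨c, hct, fun y hy hyt i => ?_⟩
        have horth : ∑ j, (a j : ℝ) * (y - c) j = 0 := by
          simp [mul_sub, Finset.sum_sub_distrib, hyt, hct]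
        have hle := sum_sq_mul_sq_le_of_sum_mul_eq_zero (fun j => (a j : ℝ))
          (y - c).ofLp horth i
        rw [← hQ, ← EuclideanSpace.real_norm_sq_eq, ← dist_eq_norm] at hle
        have hd : dist y c ^ 2 ≤ (t * √Q / S) ^ 2 := by gcongr
        have hsq : √(Q - (a i : ℝ) ^ 2) ^ 2 = Q - (a i : ℝ) ^ 2 :=
          Real.sq_sqrt (sub_pos.mpr (hlt i)).le
        have hci : c i = t / S * √(Q - (a i : ℝ) ^ 2) := rfl
        have hfin : (y - c) i ^ 2 ≤ c i ^ 2 := by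
          refine le_of_mul_le_mul_left (hle.trans ?_) hQ0
          calc _ ≤ (Q - (a i : ℝ) ^ 2) * (t * √Q / S) ^ 2 :=
                mul_le_mul_of_nonneg_left hd (sub_pos.mpr (hlt i)).le
            _ = Q * c i ^ 2 := by
                rw [hci, mul_pow, hsq, div_pow, mul_pow, Real.sq_sqrt hQ0.le]
                ring
        have hc0 : 0 ≤ c i := by
          rw [hci]
          have := hs i
          positivity
        have := (abs_le.mp (abs_le_of_sq_le_sq hfin hc0)).1
        rw [PiLp.sub_apply] at this
        linarith
end

section
/- Let N ≥ 3 and let 3 ≤ a_1 < a_2 < ... < a_N be relatively prime positive integers forming a reduced N-tuple a. Then the Frobenius number satisfies F(a) ≤ ⌊ ((N−1)²/ω_{N-1})·Σ_{i=1}^N a_i·√(‖a‖² − a_i²) + 1 ⌋, where ω_{N-1} = π^{(N-1)/2}/Γ((N+1)/2) and ‖a‖ = √(Σ_{i=1}^N a_i²). -/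
open scoped BigOperators

/-- The `N`-tuple `a` is reduced: no `a i` (for `i > 1` in 1-based indexing) is a non-negative
integer combination of the previous ones. -/
def Reduced (N : ℕ) (a : Fin N → ℕ) : Prop :=
  ∀ i : Fin N, 0 < (i : ℕ) →
    ¬ ∃ x : Fin N → ℕ, a i = ∑ j ∈ Finset.univ.filter (fun j => j < i), a j * x j

/-- `F` is the Frobenius number of the `N`-tuple `a`. -/
def IsFrobenius (N : ℕ) (a : Fin N → ℕ) (F : ℕ) : Prop :=
  IsGreatest {m : ℕ | 0 < m ∧ ¬ ∃ x : Fin N → ℕ, ∑ i, a i * x i = m} F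

theorem pi_rpow_div_Gamma_pos (n : ℕ) :
    0 < Real.pi ^ ((n : ℝ) / 2) / Real.Gamma ((n : ℝ) / 2 + 1) :=
  div_pos (Real.rpow_pos_of_pos Real.pi_pos _) (Real.Gamma_pos_of_pos (by positivity))

/-- The volume of the unit ball in dimension `n ≥ 2` is at most `n ^ 2`. -/
theorem pi_rpow_div_Gamma_le_sq (n : ℕ) (hn : 2 ≤ n) :
    Real.pi ^ ((n : ℝ) / 2) / Real.Gamma ((n : ℝ) / 2 + 1) ≤ (n : ℝ) ^ 2 := by
  induction n using Nat.strong_induction_on with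
  | _ n ih =>
    rcases Nat.lt_or_ge n 4 with h | h
    · interval_cases n
      · have h2 : Real.Gamma 2 = 1 := Real.Gamma_two
        norm_num [h2]
        linarith [Real.pi_le_four]
      · have hG : Real.Gamma ((3 : ℝ) / 2 + 1) = 3 / 4 * Real.sqrt Real.pi := by
          rw [Real.Gamma_add_one (by norm_num), show (3 : ℝ) / 2 = 1 / 2 + 1 by norm_num,
            Real.Gamma_add_one (by norm_num), Real.Gamma_one_half_eq]
          ring
        have hp : Real.pi ^ ((3 : ℝ) / 2) = Real.pi * Real.sqrt Real.pi := by
          rw [show (3 : ℝ) / 2 = 1 + 1 / 2 by norm_num, Real.rpow_add Real.pi_pos, Real.rpow_one,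
            Real.sqrt_eq_rpow]
        have hs : 0 < Real.sqrt Real.pi := Real.sqrt_pos.2 Real.pi_pos
        push_cast
        rw [hG, hp, div_le_iff₀ (by positivity)]
        nlinarith [Real.pi_le_four]
    · obtain ⟨m, rfl⟩ : ∃ m, n = m + 2 := ⟨n - 2, by omega⟩
      have hm := ih m (by omega) (by omega)
      have hm2 : (2 : ℝ) ≤ m := by exact_mod_cast (by omega : 2 ≤ m)
      have hpos : (0 : ℝ) < (m : ℝ) / 2 + 1 := by positivity
      have hω := pi_rpow_div_Gamma_pos m
      have hstep : Real.pi ^ (((m + 2 : ℕ) : ℝ) / 2) / Real.Gamma (((m + 2 : ℕ) : ℝ) / 2 + 1) =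
          Real.pi ^ ((m : ℝ) / 2) / Real.Gamma ((m : ℝ) / 2 + 1) *
            (Real.pi / ((m : ℝ) / 2 + 1)) := by
        rw [show ((m + 2 : ℕ) : ℝ) / 2 = (m : ℝ) / 2 + 1 by push_cast; ring,
          Real.Gamma_add_one hpos.ne', Real.rpow_add Real.pi_pos, Real.rpow_one]
        have := (Real.Gamma_pos_of_pos hpos).ne'
        field_simp
      rw [hstep]
      calc _ ≤ (m : ℝ) ^ 2 * (4 / ((m : ℝ) / 2 + 1)) := by
            gcongr
            exact Real.pi_le_four
        _ ≤ ((m + 2 : ℕ) : ℝ) ^ 2 := by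
            rw [mul_div_assoc', div_le_iff₀ hpos]
            push_cast
            nlinarith [mul_nonneg (by linarith : (0 : ℝ) ≤ m - 2) (sq_nonneg (m : ℝ))]

/-- A natural number that is not a non-negative combination of the `a i` is smaller than
`a k * ∑ i ≠ k, a i`. -/
theorem lt_mul_sum_erase_of_not_representable {ι : Type*} [Fintype ι] [DecidableEq ι]
    (a : ι → ℕ) (k : ι) (hk : 0 < a k) (hgcd : Finset.univ.gcd a = 1) (m : ℕ)
    (hm : ¬ ∃ x : ι → ℕ, ∑ i, a i * x i = m) :
    m < ∑ i ∈ Finset.univ.erase k, a i * a k := by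
  obtain ⟨c, hc⟩ : ∃ c : ι → ℤ, ∑ i, (a i : ℤ) * c i = 1 := by
    obtain ⟨c, hc⟩ := Finset.univ.gcd_eq_sum_mul fun i => (a i : ℤ)
    refine ⟨c, hc.symm.trans ?_⟩
    have hdvd : (Finset.univ.gcd fun i => (a i : ℤ)).natAbs ∣ Finset.univ.gcd a :=
      Finset.dvd_gcd fun i hi => Int.natAbs_dvd_natAbs.2 (Finset.gcd_dvd hi)
    rw [hgcd, Nat.dvd_one] at hdvd
    rw [← Finset.normalize_gcd, normalize_eq_one, Int.isUnit_iff_natAbs_eq]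
    exact hdvd
  have hk' : (a k : ℤ) ≠ 0 := by exact_mod_cast hk.ne'
  set x : ι → ℕ := fun i => ((m * c i) % (a k : ℤ)).toNat with hx
  have hxcast (i : ι) : (x i : ℤ) = (m * c i) % (a k : ℤ) :=
    Int.toNat_of_nonneg (Int.emod_nonneg _ hk')
  have hxlt (i : ι) : x i ≤ a k := by
    have := Int.emod_lt_of_pos (m * c i) (by exact_mod_cast hk : (0 : ℤ) < a k)
    have := hxcast i
    omega
  by_contra! hle
  have hS : ∑ i ∈ Finset.univ.erase k, a i * x i ≤ m :=
    (Finset.sum_le_sum fun i _ => Nat.mul_le_mul_left _ (hxlt i)).trans hle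
  have hdvd : (a k : ℤ) ∣ ((m - ∑ i ∈ Finset.univ.erase k, a i * x i : ℕ) : ℤ) := by
    have hmc : (m : ℤ) = ∑ i ∈ Finset.univ.erase k, (a i : ℤ) * (m * c i) + a k * (m * c k) := by
      rw [Finset.sum_erase_add _ _ (Finset.mem_univ k)]
      calc (m : ℤ) = m * ∑ i, (a i : ℤ) * c i := by rw [hc, mul_one]
        _ = _ := by rw [Finset.mul_sum]; exact Finset.sum_congr rfl fun i _ => by ring
    rw [Nat.cast_sub hS]
    nth_rewrite 1 [hmc]
    push_cast
    rw [add_sub_right_comm, ← Finset.sum_sub_distrib]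
    refine dvd_add (Finset.dvd_sum fun i _ => ?_) (dvd_mul_right _ _)
    rw [← mul_sub, hxcast]
    exact (Int.dvd_self_sub_emod).mul_left _
  obtain ⟨y, hy⟩ := Int.natCast_dvd_natCast.1 hdvd
  refine hm ⟨Function.update x k y, ?_⟩
  rw [← Finset.sum_erase_add _ _ (Finset.mem_univ k), Function.update_self,
    Finset.sum_congr rfl fun i hi => by rw [Function.update_of_ne (Finset.ne_of_mem_erase hi)],
    ← hy]
  omega

theorem frobenius_le_general_bound
    (N : ℕ) (hN : 3 ≤ N) (a : Fin N → ℕ)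
    (ha3 : 3 ≤ a ⟨0, by omega⟩) (hmono : StrictMono a)
    (hgcd : Finset.univ.gcd a = 1) (hred : Reduced N a)
    (F : ℕ) (hF : IsFrobenius N a F) :
    (F : ℤ) ≤
      ⌊(((N : ℝ) - 1) ^ 2 /
          (Real.pi ^ (((N : ℝ) - 1) / 2) / Real.Gamma (((N : ℝ) + 1) / 2))) *
        (∑ i, (a i : ℝ) * Real.sqrt ((∑ j, (a j : ℝ) ^ 2) - (a i : ℝ) ^ 2)) + 1⌋ := by
  rw [Int.le_floor]
  push_cast
  set k : Fin N := ⟨0, by omega⟩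
  have hlt := lt_mul_sum_erase_of_not_representable a k (by omega) hgcd F hF.1.2
  have hlt' : (F : ℝ) ≤ ∑ i ∈ Finset.univ.erase k, (a i : ℝ) * a k := by exact_mod_cast hlt.le
  have hsum : ∑ i ∈ Finset.univ.erase k, (a i : ℝ) * a k ≤
      ∑ i, (a i : ℝ) * Real.sqrt ((∑ j, (a j : ℝ) ^ 2) - (a i : ℝ) ^ 2) := by
    refine (Finset.sum_le_sum fun i hi => ?_).trans
      (Finset.sum_le_sum_of_subset_of_nonneg (Finset.erase_subset k _) fun i _ _ => by positivity)
    refine mul_le_mul_of_nonneg_left (Real.le_sqrt_of_sq_le ?_) (Nat.cast_nonneg _)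
    rw [← Finset.sum_erase_eq_sub (Finset.mem_univ i)]
    exact Finset.single_le_sum (f := fun j => (a j : ℝ) ^ 2) (fun j _ => sq_nonneg _)
      (Finset.mem_erase.2 ⟨(Finset.ne_of_mem_erase hi).symm, Finset.mem_univ k⟩)
  have hcoef : 1 ≤ ((N : ℝ) - 1) ^ 2 /
      (Real.pi ^ (((N : ℝ) - 1) / 2) / Real.Gamma (((N : ℝ) + 1) / 2)) := by
    have hcast : ((N - 1 : ℕ) : ℝ) = (N : ℝ) - 1 := by
      rw [Nat.cast_sub (by omega), Nat.cast_one]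
    have hle := pi_rpow_div_Gamma_le_sq (N - 1) (by omega)
    have hpos := pi_rpow_div_Gamma_pos (N - 1)
    rw [hcast, show ((N : ℝ) - 1) / 2 + 1 = ((N : ℝ) + 1) / 2 by ring] at hle hpos
    exact (one_le_div hpos).2 hle
  have hnonneg := (Nat.cast_nonneg (α := ℝ) F).trans (hlt'.trans hsum)
  linarith [le_mul_of_one_le_left hnonneg hcoef]
end

section
/- For every integer t of the form t = 13s + 2 with s a positive integer, gcd(7t² − 174, 6t² − 125) = 1; consequently gcd(6t² − 13t − 216, 6t² − 125, 7t² − 174, t³ − 36t − 78) = 1 for all such t. -/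
/-- With `A = 7t² - 174` and `B = 6t² - 125` one has `7B - 6A = 13²`, and `B ≡ 3 (mod 13)` for
`t = 13s + 2`, which yields an explicit Bézout relation. -/
theorem isCoprime_seven_mul_sq_sub_six_mul_sq_sub (s : ℤ) :
    IsCoprime (7 * (13 * s + 2) ^ 2 - 174) (6 * (13 * s + 2) ^ 2 - 125) :=
  ⟨-6 * (2 + 9 * (78 * s ^ 2 + 24 * s - 8)) ^ 2,
    18 - 81 * (6 * (13 * s + 2) ^ 2 - 125) + 7 * (2 + 9 * (78 * s ^ 2 + 24 * s - 8)) ^ 2,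
    by ring⟩

theorem gcd_family_eq_one (s : ℤ) (hs : 0 < s) :
    Int.gcd (7 * (13 * s + 2) ^ 2 - 174) (6 * (13 * s + 2) ^ 2 - 125) = 1 ∧
    Int.gcd (Int.gcd (Int.gcd
        (6 * (13 * s + 2) ^ 2 - 13 * (13 * s + 2) - 216)
        (6 * (13 * s + 2) ^ 2 - 125))
        (7 * (13 * s + 2) ^ 2 - 174))
      ((13 * s + 2) ^ 3 - 36 * (13 * s + 2) - 78) = 1 := by
  have h := isCoprime_seven_mul_sq_sub_six_mul_sq_sub s
  refine ⟨Int.isCoprime_iff_gcd_eq_one.mp h, ?_⟩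
  have h' : Int.gcd (Int.gcd
      (6 * (13 * s + 2) ^ 2 - 13 * (13 * s + 2) - 216)
      (6 * (13 * s + 2) ^ 2 - 125))
      (7 * (13 * s + 2) ^ 2 - 174) = 1 :=
    Int.isCoprime_iff_gcd_eq_one.mp (h.symm.of_isCoprime_of_dvd_left (Int.gcd_dvd_right _ _))
  rw [h', Nat.cast_one, Int.one_gcd]
end
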